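/- Let M ≥ 1, let k ≥ 3, and let Ω ⊆ [0, π/2] satisfy the order-M lacunary covering property. Let B_{Ω,k} denote the collection of all convex polygons B ⊆ [0,1]² with at most k sides each of whose outward unit normals is of the form ±(cos θ, sin θ) for some θ ∈ Ω. Then there exists a constant C (depending on k and Ω) such that for every N ≥ 2 there is a set P of N points in [0,1]² with, for every B ∈ B_{Ω,k}, |#(P ∩ B) − N·area(B)| ≤ C (log N)^{2M+1}. -/

import Mathlib

open MeasureTheory

noncomputable section

/-- The unit square `[0,1]²`. -/
def unitSq : Set (ℝ × ℝ) := Set.Icc (0:ℝ) 1 ×ˢ Set.Icc (0:ℝ) 1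

/-- `plog n = max {1, log₂ n}`. -/
def plog (n : ℕ) : ℝ := max 1 (Real.logb 2 n)

/-- `Ω` satisfies the order-`M` lacunary covering property: there is a constant `K` such
that for every `0 < δ < 1/2` the set `Ω` can be covered by at most `K (log₂(1/δ))^M`
intervals of length `δ`. -/
def LacunaryCovering (Ω : Set ℝ) (M : ℕ) : Prop :=
  ∃ K : ℝ, ∀ δ : ℝ, 0 < δ → δ < 1 / 2 →
    ∃ s : Finset ℝ, (s.card : ℝ) ≤ K * (Real.logb 2 (1 / δ)) ^ M ∧
      Ω ⊆ ⋃ x ∈ s, Set.Icc x (x + δ)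

/-- `B` is a convex polygon with at most `k` sides whose outward normals are of the
form `±(cos θ, sin θ)` with `θ ∈ Ω`: a bounded intersection of at most `k` closed
halfplanes `{x : x ⬝ u ≤ c}` with `u = ±(cos θ, sin θ)`, `θ ∈ Ω`. -/
def IsDirPolygon (Ω : Set ℝ) (k : ℕ) (B : Set (ℝ × ℝ)) : Prop :=
  Bornology.IsBounded B ∧
  ∃ m : ℕ, m ≤ k ∧ ∃ (θ : Fin m → ℝ) (ε : Fin m → ℝ) (c : Fin m → ℝ),
    (∀ j, θ j ∈ Ω) ∧ (∀ j, ε j = 1 ∨ ε j = -1) ∧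
    B = ⋂ j, {x : ℝ × ℝ |
      x.1 * (ε j * Real.cos (θ j)) + x.2 * (ε j * Real.sin (θ j)) ≤ c j}

/-- The centred sawtooth function `x ↦ {x} - 1/2`. -/
def saw (x : ℝ) : ℝ := Int.fract x - 1 / 2

/-- An arithmetic progression of `q` terms with step coprime to `q` visits every residue. -/
theorem sum_emod_range (q : ℕ) (hq : 0 < q) (p i : ℤ) (hpq : IsCoprime p (q : ℤ)) :
    ∑ n ∈ Finset.range q, (((i + p * n) % (q : ℤ) : ℤ) : ℝ) = ∑ n ∈ Finset.range q, (n : ℝ) := by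
  have hq' : (0 : ℤ) < q := by exact_mod_cast hq
  have hinj : Set.InjOn (fun n : ℕ => ((i + p * n) % (q : ℤ)).toNat) (Finset.range q) := by
    intro a ha b hb hab
    simp only [Finset.coe_range, Set.mem_Iio] at ha hb
    have h1 := Int.emod_nonneg (i + p * a) hq'.ne'
    have h2 := Int.emod_nonneg (i + p * b) hq'.ne'
    have h3 : (i + p * a) % (q : ℤ) = (i + p * b) % (q : ℤ) := by
      simp only at hab
      omega
    have h4 : (q : ℤ) ∣ p * (a - b) := by
      have h5 := (Int.emod_eq_emod_iff_emod_sub_eq_zero).1 h3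
      have h6 := Int.dvd_of_emod_eq_zero h5
      convert h6 using 1; ring
    have h7 : (q : ℤ) ∣ (a - b : ℤ) := hpq.symm.dvd_of_dvd_mul_left h4
    have h8 : (a - b : ℤ) = 0 := by
      apply Int.eq_zero_of_abs_lt_dvd h7
      rw [abs_lt]; omega
    omega
  have himg : (Finset.range q).image (fun n : ℕ => ((i + p * n) % (q : ℤ)).toNat)
      = Finset.range q := by
    apply Finset.eq_of_subset_of_card_le
    · intro x hx
      simp only [Finset.mem_image, Finset.mem_range] at hx ⊢
      obtain ⟨n, -, rfl⟩ := hx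
      have h1 := Int.emod_nonneg (i + p * n) hq'.ne'
      have h2 := Int.emod_lt_of_pos (i + p * n) hq'
      omega
    · rw [Finset.card_image_of_injOn hinj]
  conv_rhs => rw [← himg, Finset.sum_image hinj]
  refine Finset.sum_congr rfl fun n _ => ?_
  have h1 := Int.emod_nonneg (i + p * n) hq'.ne'
  have : ((((i + p * n) % (q : ℤ)).toNat : ℤ) : ℝ) = (((i + p * n) % (q : ℤ) : ℤ) : ℝ) := by
    rw [Int.toNat_of_nonneg h1]
  rw [← this, Int.cast_natCast]

theorem sum_saw_rational (q : ℕ) (hq : 0 < q) (p : ℤ) (hpq : IsCoprime p (q : ℤ)) (x : ℝ) :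
    |∑ n ∈ Finset.range q, saw (x + p * n / q)| ≤ 1 / 2 := by
  have hq' : (0 : ℝ) < q := by exact_mod_cast hq
  have hqz : (0 : ℤ) < q := by exact_mod_cast hq
  set i : ℤ := ⌊q * x⌋ with hi
  set y : ℝ := Int.fract (q * x) with hy
  have hxy : x = (i + y) / q := by
    rw [hi, hy, Int.floor_add_fract]; field_simp
  have hy0 : 0 ≤ y := Int.fract_nonneg _
  have hy1 : y < 1 := Int.fract_lt_one _
  have key : ∀ n : ℕ, saw (x + p * n / q)
      = y / q - 1 / 2 + (((i + p * n) % (q : ℤ) : ℤ) : ℝ) / q := by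
    intro n
    have h1 := Int.emod_nonneg (i + p * n) hqz.ne'
    have h2 := Int.emod_lt_of_pos (i + p * n) hqz
    have h3 : ((i + p * n : ℤ) : ℝ) = ((i + p * n) % (q : ℤ) : ℤ) + q * ((i + p * n) / (q : ℤ) : ℤ) := by
      exact_mod_cast (Int.emod_add_mul_ediv (i + p * n) q).symm
    push_cast at h3
    set e : ℤ := (i + p * n) % (q : ℤ)
    set d : ℤ := (i + p * n) / (q : ℤ)
    have h4 : x + p * n / q = (y + e) / q + d := by
      rw [hxy]; field_simp; linarith
    have h1' : (0 : ℝ) ≤ e := by exact_mod_cast h1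
    have h2' : (e : ℝ) + 1 ≤ q := by exact_mod_cast h2
    rw [saw, h4, Int.fract_add_intCast, Int.fract_eq_self.2]
    · ring
    · constructor
      · positivity
      · rw [div_lt_one hq']; linarith
  simp_rw [key]
  rw [Finset.sum_add_distrib, ← Finset.sum_div, sum_emod_range q hq p i hpq]
  have hg : ∑ n ∈ Finset.range q, (n : ℝ) = q * (q - 1) / 2 := by
    have := Finset.sum_range_id_mul_two q
    have h : ((∑ n ∈ Finset.range q, n : ℕ) : ℝ) * 2 = q * (q - 1) := by
      rw [← Nat.cast_pred hq]; exact_mod_cast this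
    push_cast at h; linarith
  rw [hg, Finset.sum_const, Finset.card_range, nsmul_eq_mul]
  have : (q : ℝ) * (y / q - 1 / 2) + q * (q - 1) / 2 / q = y - 1 / 2 := by
    field_simp; ring
  rw [this, abs_le]; constructor <;> linarith

theorem saw_between (y e h : ℝ) (he : |e| ≤ h) :
    saw (y + h) - 2 * h ≤ saw (y + e) ∧ saw (y + e) ≤ saw (y - h) + 2 * h := by
  have := abs_le.1 he
  have h1 : (⌊y + e⌋ : ℝ) ≤ ⌊y + h⌋ := by exact_mod_cast Int.floor_mono (by linarith)
  have h2 : (⌊y - h⌋ : ℝ) ≤ ⌊y + e⌋ := by exact_mod_cast Int.floor_mono (by linarith)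
  simp only [saw, Int.fract]
  constructor <;> linarith

theorem sum_saw_block (q : ℕ) (hq : 0 < q) (p : ℤ) (hpq : IsCoprime p (q : ℤ)) (s a : ℝ)
    (hs : |s - p / q| ≤ 1 / (q : ℝ) ^ 2) :
    |∑ n ∈ Finset.range q, saw (a + s * n)| ≤ 5 / 2 := by
  have hq' : (0 : ℝ) < q := by exact_mod_cast hq
  have key : ∀ n ∈ Finset.range q,
      saw ((a + 1 / q) + p * n / q) - 2 * (1 / q) ≤ saw (a + s * n) ∧
      saw (a + s * n) ≤ saw ((a - 1 / q) + p * n / q) + 2 * (1 / q) := by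
    intro n hn
    have hn' : (n : ℝ) ≤ q := by exact_mod_cast (Finset.mem_range.1 hn).le
    have he : |(s - p / q) * n| ≤ 1 / q := by
      rw [abs_mul, Nat.abs_cast]
      calc _ ≤ 1 / (q : ℝ) ^ 2 * q := by gcongr
        _ = 1 / q := by field_simp
    have := saw_between (a + p * n / q) _ _ he
    have e1 : a + p * n / q + (s - p / q) * n = a + s * n := by ring
    rw [e1] at this
    convert this using 4 <;> ring
  have h1 := sum_saw_rational q hq p hpq (a + 1 / q)
  have h2 := sum_saw_rational q hq p hpq (a - 1 / q)
  have h3 := Finset.sum_le_sum fun n hn => (key n hn).1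
  have h4 := Finset.sum_le_sum fun n hn => (key n hn).2
  rw [Finset.sum_sub_distrib, Finset.sum_const, Finset.card_range, nsmul_eq_mul] at h3
  rw [Finset.sum_add_distrib, Finset.sum_const, Finset.card_range, nsmul_eq_mul] at h4
  have h5 : (q : ℝ) * (2 * (1 / q)) = 2 := by field_simp
  rw [h5] at h3 h4
  rw [abs_le] at *
  constructor <;> linarith [h1.1, h2.2]

/-- `s` is badly approximable with constant `A` by fractions of denominator at most `Q`. -/
def BadlyApprox (A : ℝ) (Q : ℕ) (s : ℝ) : Prop :=
  ∀ q : ℕ, 1 ≤ q → q ≤ Q → ∀ p : ℤ, 1 / (A * (q : ℝ) ^ 2) ≤ |s - p / q|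

theorem BadlyApprox.neg {A : ℝ} {Q : ℕ} {s : ℝ} (h : BadlyApprox A Q s) :
    BadlyApprox A Q (-s) := by
  intro q h1 h2 p
  have := h q h1 h2 (-p)
  rw [← abs_neg]
  convert this using 2
  push_cast; ring

theorem sum_saw_blocks (q : ℕ) (f : ℕ → ℝ) (b : ℝ)
    (hf : ∀ c : ℕ, |∑ n ∈ Finset.range q, f (c + n)| ≤ b) (m : ℕ) :
    |∑ n ∈ Finset.range (q * m), f n| ≤ b * m := by
  induction m with
  | zero => simp
  | succ m ih =>
    rw [Nat.mul_succ, Finset.sum_range_add]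
    push_cast
    have := hf (q * m)
    have h := abs_add_le (∑ n ∈ Finset.range (q * m), f n) (∑ n ∈ Finset.range q, f (q * m + n))
    linarith

theorem sum_saw_le {A : ℝ} (hA : 0 < A) {Q : ℕ} {s : ℝ} (hs : BadlyApprox A Q s) (j : ℕ) :
    ∀ H : ℕ, H < 2 ^ j → H ≤ Q → ∀ a : ℝ,
      |∑ n ∈ Finset.range H, saw (a + s * n)| ≤ 5 / 2 * A * j := by
  induction j with
  | zero =>
    intro H hH _ a
    have : H = 0 := by simpa using hH
    subst this; simp
  | succ j ih =>
    intro H hH hQ a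
    rcases Nat.eq_zero_or_pos H with rfl | hpos
    · simp; positivity
    obtain ⟨x, hx, hxH⟩ := Real.exists_rat_abs_sub_le_and_den_le s hpos
    set q := x.den with hqdef
    have hq : 0 < q := x.den_pos
    have hq' : (0 : ℝ) < q := by exact_mod_cast hq
    have hxq : (x : ℝ) = x.num / q := by exact_mod_cast (Rat.num_div_den x).symm
    rw [hxq] at hx
    have hqH : (q : ℝ) ≤ H := by exact_mod_cast hxH
    have hcop : IsCoprime x.num (q : ℤ) := by
      rw [Int.isCoprime_iff_gcd_eq_one]; exact x.reduced
    have hblock : ∀ c : ℕ, |∑ n ∈ Finset.range q, saw (a + s * (c + n : ℕ))| ≤ 5 / 2 := by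
      intro c
      have := sum_saw_block q hq x.num hcop s (a + s * c) (hx.trans (by
        rw [sq]; gcongr; linarith))
      convert this using 4
      push_cast; ring
    have hbig : (H : ℝ) + 1 ≤ A * q := by
      have h1 := (hs q hq (hxH.trans hQ) x.num).trans hx
      rw [one_div_le_one_div (by positivity) (by positivity)] at h1
      have : ((H : ℝ) + 1) * q ≤ (A * q) * q := by nlinarith
      exact le_of_mul_le_mul_right this hq'
    have hm : ((H / q : ℕ) : ℝ) ≤ A := by
      calc ((H / q : ℕ) : ℝ) ≤ H / q := Nat.cast_div_le
        _ ≤ A := by rw [div_le_iff₀ hq']; linarith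
    have h1 := sum_saw_blocks q (fun n => saw (a + s * n)) (5 / 2) hblock (H / q)
    have hmod : H % q < q := Nat.mod_lt _ hq
    have hdm := Nat.div_add_mod H q
    have hdpos : 1 ≤ H / q := Nat.div_pos hxH hq
    have hqm : q ≤ q * (H / q) := Nat.le_mul_of_pos_right _ hdpos
    have h2 := ih (H % q) (by rw [pow_succ] at hH; omega) (by omega) (a + s * (q * (H / q) : ℕ))
    have h3 : ∑ n ∈ Finset.range H, saw (a + s * n)
        = ∑ n ∈ Finset.range (q * (H / q)), saw (a + s * n) +
          ∑ n ∈ Finset.range (H % q), saw (a + s * (q * (H / q) : ℕ) + s * n) := by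
      conv_lhs => rw [← hdm]
      rw [Finset.sum_range_add]
      congr 1
      refine Finset.sum_congr rfl fun n _ => ?_
      push_cast; ring_nf
    rw [h3]
    refine (abs_add_le _ _).trans ?_
    push_cast at *
    nlinarith

theorem sum_saw_ordConnected {A : ℝ} (hA : 0 < A) {Q : ℕ} {s : ℝ} (hs : BadlyApprox A Q s)
    {j : ℕ} (hj : Q < 2 ^ j) (T : Finset ℤ) (hT : (T : Set ℤ).OrdConnected) (hcard : T.card ≤ Q)
    (a : ℝ) : |∑ n ∈ T, saw (s * n + a)| ≤ 5 / 2 * A * j := by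
  rcases T.eq_empty_or_nonempty with rfl | hne
  · simp; positivity
  have hTI : T = Finset.Icc (T.min' hne) (T.max' hne) := by
    ext x
    rw [Finset.mem_Icc]
    constructor
    · intro hx
      exact ⟨T.min'_le x hx, T.le_max' x hx⟩
    · rintro ⟨h1, h2⟩
      exact hT.out (T.min'_mem hne) (T.max'_mem hne) ⟨h1, h2⟩
  set u := T.min' hne
  have hTim : T = (Finset.range T.card).image (fun n : ℕ => u + (n : ℤ)) := by
    have hc : T.card = (T.max' hne + 1 - u).toNat := by
      conv_lhs => rw [hTI]
      simp
    ext x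
    rw [Finset.mem_image, hc]
    conv_lhs => rw [hTI, Finset.mem_Icc]
    constructor
    · rintro ⟨h1, h2⟩
      exact ⟨(x - u).toNat, by simp; omega, by omega⟩
    · rintro ⟨n, hn, rfl⟩
      simp at hn; omega
  have := sum_saw_le hA hs j T.card (hcard.trans_lt hj) hcard (a + s * u)
  rw [hTim, Finset.sum_image (by intro a _ b _ h; simpa using h)]
  convert this using 4
  push_cast; ring_nf

theorem ordConnected_lex_affine (s t a b : ℝ) (i j : ℕ) :
    {n : ℤ | toLex (s * n + a, i) ≤ toLex (t * n + b, j)}.OrdConnected := by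
  constructor
  intro x hx y hy z hz
  simp only [Set.mem_ofPred_eq, Prod.Lex.toLex_le_toLex] at hx hy ⊢
  have h1 : (x : ℝ) ≤ z := by exact_mod_cast hz.1
  have h2 : (z : ℝ) ≤ y := by exact_mod_cast hz.2
  have hcomb : ∃ l : ℝ, 0 ≤ l ∧ l ≤ 1 ∧ (z : ℝ) = l * x + (1 - l) * y := by
    rcases eq_or_lt_of_le (h1.trans h2) with h | h
    · exact ⟨1, by norm_num, le_rfl, by linarith⟩
    · refine ⟨(y - z) / (y - x), div_nonneg (by linarith) (by linarith), ?_, ?_⟩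
      · rw [div_le_one (by linarith)]; linarith
      · have : (y : ℝ) - x ≠ 0 := by linarith
        field_simp; ring
  obtain ⟨l, hl0, hl1, hz'⟩ := hcomb
  by_cases hij : i ≤ j
  · have hx' : s * x + a ≤ t * x + b := by rcases hx with h | h <;> [exact h.le; exact h.1.le]
    have hy' : s * y + a ≤ t * y + b := by rcases hy with h | h <;> [exact h.le; exact h.1.le]
    have : s * z + a ≤ t * z + b := by rw [hz']; nlinarith
    rcases this.lt_or_eq with h | h
    · exact Or.inl h
    · exact Or.inr ⟨h, hij⟩
  · have hx' : s * x + a < t * x + b := by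
      rcases hx with h | h
      · exact h
      · exact absurd h.2 hij
    have hy' : s * y + a < t * y + b := by
      rcases hy with h | h
      · exact h
      · exact absurd h.2 hij
    left
    rw [hz']
    rcases eq_or_lt_of_le hl0 with h | h
    · rw [← h]; nlinarith
    · nlinarith

/-- `F` is the lower envelope of the affine functions `x ↦ s i * x + a i`. -/
structure IsEnvelope {ι : Type*} (F : ℝ → ℝ) (s a : ι → ℝ) : Prop where
  le : ∀ x i, F x ≤ s i * x + a i
  eq : ∀ x, ∃ i, F x = s i * x + a i

theorem exists_isEnvelope {ι : Type*} [Fintype ι] [Nonempty ι] (s a : ι → ℝ) :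
    ∃ F : ℝ → ℝ, IsEnvelope F s a := by
  refine ⟨fun x => Finset.univ.inf' Finset.univ_nonempty fun i => s i * x + a i, ?_, ?_⟩
  · intro x i
    exact Finset.inf'_le _ (Finset.mem_univ i)
  · intro x
    obtain ⟨i, -, hi⟩ := Finset.exists_mem_eq_inf' Finset.univ_nonempty fun i => s i * x + a i
    exact ⟨i, hi⟩

theorem sum_saw_envelope {A : ℝ} (hA : 0 < A) {Q : ℕ} {j : ℕ} (hj : Q < 2 ^ j)
    {ι : Type*} [Fintype ι] {s a : ι → ℝ} {F : ℝ → ℝ} (hF : IsEnvelope F s a)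
    (hs : ∀ i, BadlyApprox A Q (s i))
    (T : Finset ℤ) (hT : (T : Set ℤ).OrdConnected) (hcard : T.card ≤ Q) :
    |∑ n ∈ T, saw (F n)| ≤ Fintype.card ι * (5 / 2 * A * j) := by
  classical
  have : Nonempty ι := ⟨(hF.eq 0).choose⟩
  let e : ι → ℕ := fun i => (Fintype.equivFin ι i : ℕ)
  have he : Function.Injective e := Fin.val_injective.comp (Fintype.equivFin ι).injective
  have hex : ∀ n : ℤ, ∃ i, ∀ i', toLex (s i * n + a i, e i) ≤ toLex (s i' * n + a i', e i') := by
    intro n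
    obtain ⟨i, -, hi⟩ := Finset.exists_min_image Finset.univ
      (fun i => toLex (s i * (n : ℝ) + a i, e i)) Finset.univ_nonempty
    exact ⟨i, fun i' => hi i' (Finset.mem_univ _)⟩
  choose φ hφ using hex
  have hval : ∀ n : ℤ, F n = s (φ n) * n + a (φ n) := by
    intro n
    obtain ⟨i, hi⟩ := hF.eq n
    refine le_antisymm (hF.le _ _) ?_
    rw [hi]
    have := hφ n i
    rw [Prod.Lex.toLex_le_toLex] at this
    rcases this with h | h <;> [exact h.le; exact h.1.le]
  have hfib : ∀ i, ∀ n : ℤ, φ n = i ↔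
      ∀ i', toLex (s i * n + a i, e i) ≤ toLex (s i' * n + a i', e i') := by
    intro i n
    constructor
    · rintro rfl; exact hφ n
    · intro h
      have := le_antisymm (h (φ n)) (hφ n i)
      have h2 : e i = e (φ n) := congrArg (fun z => (ofLex z).2) this
      exact (he h2).symm
  rw [← Finset.sum_fiberwise T φ]
  calc _ ≤ ∑ i, |∑ n ∈ T with φ n = i, saw (F n)| := Finset.abs_sum_le_sum_abs _ _
    _ ≤ ∑ _i : ι, (5 / 2 * A * j) := by
        refine Finset.sum_le_sum fun i _ => ?_
        have h1 : ∑ n ∈ T with φ n = i, saw (F n)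
            = ∑ n ∈ T with φ n = i, saw (s i * n + a i) := by
          refine Finset.sum_congr rfl fun n hn => ?_
          rw [hval, (Finset.mem_filter.1 hn).2]
        rw [h1]
        refine sum_saw_ordConnected hA (hs i) hj _ ?_
          ((Finset.card_le_card (Finset.filter_subset _ _)).trans hcard) _
        have h2 : ((T.filter fun n => φ n = i : Finset ℤ) : Set ℤ) = (T : Set ℤ) ∩
            ⋂ i', {n : ℤ | toLex (s i * n + a i, e i) ≤ toLex (s i' * n + a i', e i')} := by
          ext n
          simp [hfib]
        rw [h2]
        exact hT.inter (Set.ordConnected_iInter fun i' => ordConnected_lex_affine _ _ _ _ _ _)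
    _ = _ := by simp

theorem integral_affine_unit (n u v : ℝ) :
    ∫ x in n..(n + 1), (u + (x - n) * v) = u + v / 2 := by
  have h : ∀ x ∈ Set.uIcc n (n + 1),
      HasDerivAt (fun x => u * x + (x - n) ^ 2 * v / 2) (u + (x - n) * v) x := by
    intro x _
    have h1 : HasDerivAt (fun x : ℝ => u * x) u x := by
      simpa using (hasDerivAt_id x).const_mul u
    have h2 : HasDerivAt (fun x : ℝ => (x - n) ^ 2) (2 * (x - n)) x := by
      simpa using ((hasDerivAt_id x).sub_const n).fun_pow 2
    exact (h1.fun_add ((h2.mul_const v).div_const 2)).congr_deriv (by ring)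
  rw [intervalIntegral.integral_eq_sub_of_hasDerivAt h
    (Continuous.intervalIntegrable (by fun_prop) _ _)]
  ring

theorem ConvexOn.trapezoid_unit {g : ℝ → ℝ} (hg : ConvexOn ℝ Set.univ g) (hc : Continuous g)
    (n : ℝ) :
    ∫ x in n..(n + 1), g x ≤ (g n + g (n + 1)) / 2 ∧
    (g n + g (n + 1)) / 2 - ∫ x in n..(n + 1), g x
      ≤ ((g (n + 1) - g n) - (g n - g (n - 1))) / 2 := by
  have hle : n ≤ n + 1 := by linarith
  have hi := hc.intervalIntegrable (μ := volume) n (n + 1)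
  constructor
  · have h : ∫ x in n..(n + 1), g x ≤ ∫ x in n..(n + 1), (g n + (x - n) * (g (n + 1) - g n)) := by
      refine intervalIntegral.integral_mono_on hle hi
        (Continuous.intervalIntegrable (by fun_prop) _ _) fun x hx => ?_
      have := hg.2 (Set.mem_univ n) (Set.mem_univ (n + 1))
        (show 0 ≤ 1 - (x - n) by linarith [hx.2]) (show 0 ≤ x - n by linarith [hx.1]) (by ring)
      simp only [smul_eq_mul] at this
      have e : (1 - (x - n)) * n + (x - n) * (n + 1) = x := by ring
      rw [e] at this
      linarith
    rw [integral_affine_unit] at h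
    linarith
  · have h : ∫ x in n..(n + 1), (g n + (x - n) * (g n - g (n - 1))) ≤ ∫ x in n..(n + 1), g x := by
      refine intervalIntegral.integral_mono_on hle
        (Continuous.intervalIntegrable (by fun_prop) _ _) hi fun x hx => ?_
      have hp : 0 < 1 + (x - n) := by linarith [hx.1]
      have := hg.2 (Set.mem_univ (n - 1)) (Set.mem_univ x)
        (show 0 ≤ (x - n) / (1 + (x - n)) from div_nonneg (by linarith [hx.1]) hp.le)
        (show 0 ≤ 1 / (1 + (x - n)) by positivity) (by field_simp; ring)
      simp only [smul_eq_mul] at this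
      have e : (x - n) / (1 + (x - n)) * (n - 1) + 1 / (1 + (x - n)) * x = n := by
        field_simp; ring
      rw [e] at this
      have h2 := mul_le_mul_of_nonneg_left this hp.le
      have e2 : (1 + (x - n)) * ((x - n) / (1 + (x - n)) * g (n - 1) + 1 / (1 + (x - n)) * g x)
          = (x - n) * g (n - 1) + g x := by field_simp
      rw [e2] at h2
      linarith
    rw [integral_affine_unit] at h
    linarith

theorem ConvexOn.trapezoid {g : ℝ → ℝ} (hg : ConvexOn ℝ Set.univ g) {Λ : NNReal}
    (hL : LipschitzWith Λ g) (u : ℝ) (m : ℕ) :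
    |(∫ x in u..(u + m), g x) - ∑ n ∈ Finset.range m, (g (u + n) + g (u + n + 1)) / 2| ≤ Λ := by
  have hc := hL.continuous
  have hintegral : ∫ x in u..(u + m), g x
      = ∑ n ∈ Finset.range m, ∫ x in (u + n)..(u + n + 1), g x := by
    have := intervalIntegral.sum_integral_adjacent_intervals (f := g) (μ := volume)
      (a := fun n : ℕ => u + n) (n := m) (fun _ _ => hc.intervalIntegrable _ _)
    simp only [Nat.cast_zero, add_zero] at this
    rw [← this]
    refine Finset.sum_congr rfl fun n _ => ?_
    push_cast
    rw [add_assoc]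
  rw [hintegral, ← Finset.sum_sub_distrib]
  have h1 : ∀ n ∈ Finset.range m, (∫ x in (u + n)..(u + n + 1), g x)
      - (g (u + n) + g (u + n + 1)) / 2 ≤ 0 := fun n _ => by
    linarith [(hg.trapezoid_unit hc (u + n)).1]
  have h2 : ∀ n ∈ Finset.range m,
      (g (u + n) - g (u + n - 1)) / 2 - (g (u + (n + 1 : ℕ)) - g (u + (n + 1 : ℕ) - 1)) / 2
      ≤ (∫ x in (u + n)..(u + n + 1), g x) - (g (u + n) + g (u + n + 1)) / 2 := fun n _ => by
    have := (hg.trapezoid_unit hc (u + n)).2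
    have e1 : u + ((n + 1 : ℕ) : ℝ) = u + n + 1 := by push_cast; ring
    have e2 : u + n + 1 - 1 = u + (n : ℝ) := by ring
    rw [e1, e2]
    linarith
  have h3 := Finset.sum_nonpos h1
  have h4 := Finset.sum_le_sum h2
  rw [Finset.sum_range_sub' (fun n : ℕ => (g (u + n) - g (u + n - 1)) / 2),
    Nat.cast_zero, add_zero] at h4
  have hdiff : ∀ x, |g x - g (x - 1)| ≤ Λ := fun x => by
    have := hL.dist_le_mul x (x - 1)
    simpa [Real.dist_eq] using this
  have h5 := abs_le.1 (hdiff u)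
  have h6 := abs_le.1 (hdiff (u + m))
  rw [abs_le]
  constructor <;> linarith [Λ.coe_nonneg, h5.1, h5.2, h6.1, h6.2]

/-- Sum versus integral for the positive part of a concave Lipschitz function. -/
theorem ConcaveOn.sum_sub_integral_pos_part {w : ℝ → ℝ} (hw : ConcaveOn ℝ Set.univ w) {Λ : NNReal}
    (hL : LipschitzWith Λ w) (u : ℝ) (m : ℕ) (h0 : w u ≤ 0) (h1 : w (u + m) ≤ 0) :
    |(∑ n ∈ Finset.range m, max (w (u + n)) 0) - ∫ x in u..(u + m), max (w x) 0| ≤ 2 * Λ := by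
  have hneg : ConvexOn ℝ Set.univ (-w) := hw.neg
  have hLneg : LipschitzWith Λ (-w) := hL.neg
  have hmax : ConvexOn ℝ Set.univ ((-w) ⊔ 0) := hneg.sup (convexOn_const 0 convex_univ)
  have hLmax : LipschitzWith Λ ((-w) ⊔ 0) := hLneg.max_const 0
  have t1 := hneg.trapezoid hLneg u m
  have t2 := hmax.trapezoid hLmax u m
  have hpt : ∀ x, max (w x) 0 = ((-w) ⊔ 0) x - (-w) x := fun x => by
    simp only [Pi.sup_apply, Pi.neg_apply, Pi.zero_apply]
    rcases le_total (w x) 0 with h | h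
    · rw [max_eq_right h, max_eq_left (by linarith)]; ring
    · rw [max_eq_left h, max_eq_right (by linarith)]; ring
  have hintegral : ∫ x in u..(u + m), max (w x) 0
      = (∫ x in u..(u + m), ((-w) ⊔ 0) x) - ∫ x in u..(u + m), (-w) x := by
    rw [← intervalIntegral.integral_sub (hLmax.continuous.intervalIntegrable _ _)
      (hLneg.continuous.intervalIntegrable _ _)]
    simp_rw [hpt]
  have hsum : ∑ n ∈ Finset.range m, max (w (u + n)) 0
      = ∑ n ∈ Finset.range m, (max (w (u + n)) 0 + max (w (u + n + 1)) 0) / 2 := by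
    have := Finset.sum_range_sub (fun n : ℕ => max (w (u + n)) 0) m
    simp only [Nat.cast_zero, add_zero] at this
    rw [max_eq_right h0, max_eq_right h1, Finset.sum_sub_distrib] at this
    have e : ∀ n : ℕ, u + ((n + 1 : ℕ) : ℝ) = u + n + 1 := fun n => by push_cast; ring
    simp_rw [e] at this
    rw [← Finset.sum_div, Finset.sum_add_distrib]
    linarith
  have hsum2 : ∑ n ∈ Finset.range m, (max (w (u + n)) 0 + max (w (u + n + 1)) 0) / 2
      = (∑ n ∈ Finset.range m, (((-w) ⊔ 0) (u + n) + ((-w) ⊔ 0) (u + n + 1)) / 2)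
        - ∑ n ∈ Finset.range m, ((-w) (u + n) + (-w) (u + n + 1)) / 2 := by
    rw [← Finset.sum_sub_distrib]
    refine Finset.sum_congr rfl fun n _ => ?_
    rw [hpt, hpt]; ring
  rw [hsum, hsum2, hintegral]
  rw [abs_le] at *
  constructor <;> linarith [t1.1, t1.2, t2.1, t2.2]

theorem IsEnvelope.concaveOn {ι : Type*} {F : ℝ → ℝ} {s a : ι → ℝ} (hF : IsEnvelope F s a) :
    ConcaveOn ℝ Set.univ F := by
  refine ⟨convex_univ, fun x _ y _ l m hl hm hlm => ?_⟩
  simp only [smul_eq_mul]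
  obtain ⟨i, hi⟩ := hF.eq (l * x + m * y)
  have h1 := mul_le_mul_of_nonneg_left (hF.le x i) hl
  have h2 := mul_le_mul_of_nonneg_left (hF.le y i) hm
  rw [hi]
  have : a i = l * a i + m * a i := by rw [← add_mul, hlm, one_mul]
  linarith

theorem IsEnvelope.lipschitzWith {ι : Type*} {F : ℝ → ℝ} {s a : ι → ℝ} (hF : IsEnvelope F s a)
    {Λ : NNReal} (hs : ∀ i, |s i| ≤ Λ) : LipschitzWith Λ F := by
  refine LipschitzWith.of_le_add_mul Λ fun x y => ?_
  obtain ⟨i, hi⟩ := hF.eq y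
  have h1 := hF.le x i
  have h2 : s i * (x - y) ≤ Λ * dist x y := by
    rw [Real.dist_eq]
    refine (le_abs_self _).trans ?_
    rw [abs_mul]
    gcongr
    exact hs i
  rw [hi]; linarith

/-- The region between the graph of `-V` and the graph of `U`. -/
def envRegion (U V : ℝ → ℝ) : Set (ℝ × ℝ) := {z | -V z.1 ≤ z.2 ∧ z.2 ≤ U z.1}

theorem volume_envRegion {U V : ℝ → ℝ} (hU : Continuous U) (hV : Continuous V) {u v : ℝ}
    (huv : u ≤ v) (hout : ∀ x, x ∉ Set.Ioc u v → U x + V x ≤ 0) :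
    (volume (envRegion U V)).toReal = ∫ x in u..v, max (U x + V x) 0 := by
  have hmeas : MeasurableSet (envRegion U V) := by
    have h1 : IsClosed {z : ℝ × ℝ | -V z.1 ≤ z.2} := isClosed_le (by fun_prop) (by fun_prop)
    have h2 : IsClosed {z : ℝ × ℝ | z.2 ≤ U z.1} := isClosed_le (by fun_prop) (by fun_prop)
    exact (h1.inter h2).measurableSet
  have hslice : ∀ x, Prod.mk x ⁻¹' envRegion U V = Set.Icc (-V x) (U x) := fun x => rfl
  rw [Measure.volume_eq_prod, Measure.prod_apply hmeas]
  simp_rw [hslice, Real.volume_Icc]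
  rw [intervalIntegral.integral_of_le huv,
    integral_eq_lintegral_of_nonneg_ae (f := fun x => max (U x + V x) 0) (Filter.Eventually.of_forall fun x => le_max_right _ _)
      (by fun_prop)]
  congr 1
  rw [← lintegral_indicator measurableSet_Ioc]
  refine lintegral_congr fun x => ?_
  by_cases hx : x ∈ Set.Ioc u v
  · rw [Set.indicator_of_mem hx, sub_neg_eq_add, ENNReal.ofReal_max]
    simp
  · rw [Set.indicator_of_notMem hx, sub_neg_eq_add, ENNReal.ofReal_eq_zero]
    exact hout x hx

/-- Integer points of a region, listed column by column. -/
theorem ncard_envRegion {U V : ℝ → ℝ} (T : Finset ℤ)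
    (hT : ∀ n : ℤ, n ∈ T ↔ 0 ≤ U n + V n) :
    {z : ℤ × ℤ | ((z.1 : ℝ), (z.2 : ℝ)) ∈ envRegion U V}.Finite ∧
    ({z : ℤ × ℤ | ((z.1 : ℝ), (z.2 : ℝ)) ∈ envRegion U V}.ncard : ℝ)
      = ∑ n ∈ T, (U n + V n) - ∑ n ∈ T, saw (U n) - ∑ n ∈ T, saw (V n) := by
  classical
  let S : Finset (ℤ × ℤ) := (T.sigma fun n => Finset.Icc ⌈-V n⌉ ⌊U n⌋).map
    (Equiv.sigmaEquivProd ℤ ℤ).toEmbedding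
  have hS : {z : ℤ × ℤ | ((z.1 : ℝ), (z.2 : ℝ)) ∈ envRegion U V} = S := by
    ext ⟨n, m⟩
    simp only [envRegion, S, Finset.coe_map, Set.mem_image, Finset.mem_coe,
      Finset.mem_sigma, Finset.mem_Icc, Sigma.exists]
    constructor
    · rintro ⟨h1, h2⟩
      exact ⟨n, m, ⟨(hT n).2 (by simp at h1 h2; linarith), Int.ceil_le.2 h1, Int.le_floor.2 h2⟩, rfl⟩
    · rintro ⟨n', m', ⟨-, h1, h2⟩, h3⟩
      have h4 : (n', m') = (n, m) := h3
      obtain ⟨rfl, rfl⟩ := Prod.mk.inj h4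
      exact ⟨Int.ceil_le.1 h1, Int.le_floor.1 h2⟩
  rw [hS]
  refine ⟨S.finite_toSet, ?_⟩
  rw [Set.ncard_coe_finset, Finset.card_map, Finset.card_sigma, ← Finset.sum_sub_distrib,
    ← Finset.sum_sub_distrib]
  push_cast
  refine Finset.sum_congr rfl fun n hn => ?_
  rw [Int.card_Icc, Int.ceil_neg]
  have hw := (hT n).1 hn
  have hU := Int.floor_add_fract (U n)
  have hV := Int.floor_add_fract (V n)
  have hnn : (0 : ℤ) ≤ ⌊U n⌋ + 1 - -⌊V n⌋ := by
    have : (-1 : ℝ) < ⌊U n⌋ + ⌊V n⌋ + 1 := by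
      linarith [Int.fract_lt_one (U n), Int.fract_lt_one (V n)]
    have : (-1 : ℤ) < ⌊U n⌋ + ⌊V n⌋ + 1 := by exact_mod_cast this
    omega
  have : (((⌊U n⌋ + 1 - -⌊V n⌋).toNat : ℤ) : ℝ) = ((⌊U n⌋ + 1 - -⌊V n⌋ : ℤ) : ℝ) := by
    rw [Int.toNat_of_nonneg hnn]
  rw [Int.cast_natCast] at this
  rw [this, saw, saw]
  push_cast
  linarith

/-- Lattice point discrepancy of a polygon whose edges have badly approximable slopes. -/
theorem envRegion_discrepancy {A : ℝ} (hA : 0 < A) {Q j : ℕ} (hj : Q < 2 ^ j)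
    {ι κ : Type*} [Fintype ι] [Fintype κ] {s a : ι → ℝ} {t b : κ → ℝ} {U V : ℝ → ℝ}
    (hU : IsEnvelope U s a) (hV : IsEnvelope V t b)
    (hs : ∀ i, BadlyApprox A Q (s i)) (ht : ∀ i, BadlyApprox A Q (t i))
    (hs2 : ∀ i, |s i| ≤ 2) (ht2 : ∀ i, |t i| ≤ 2)
    {H : ℕ} (hHQ : 2 * H + 1 ≤ Q) (hout : ∀ x : ℝ, H < |x| → U x + V x < 0) :
    {z : ℤ × ℤ | ((z.1 : ℝ), (z.2 : ℝ)) ∈ envRegion U V}.Finite ∧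
    |({z : ℤ × ℤ | ((z.1 : ℝ), (z.2 : ℝ)) ∈ envRegion U V}.ncard : ℝ)
      - (volume (envRegion U V)).toReal|
      ≤ (Fintype.card ι + Fintype.card κ) * (5 / 2 * A * j) + 8 := by
  classical
  set w : ℝ → ℝ := U + V with hwdef
  have hwc : ConcaveOn ℝ Set.univ w := hU.concaveOn.add hV.concaveOn
  have hUL : LipschitzWith 2 U := hU.lipschitzWith (by simpa using hs2)
  have hVL : LipschitzWith 2 V := hV.lipschitzWith (by simpa using ht2)
  have hwL : LipschitzWith (2 + 2) w := hUL.add hVL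
  set T : Finset ℤ := (Finset.Icc (-(H : ℤ)) H).filter fun n => 0 ≤ U n + V n with hTdef
  have hT : ∀ n : ℤ, n ∈ T ↔ 0 ≤ U n + V n := by
    intro n
    rw [hTdef, Finset.mem_filter, and_iff_right_iff_imp]
    intro h
    by_contra hn
    have h1 : (H : ℝ) < |(n : ℝ)| := by
      have : (H : ℤ) < |n| := by
        by_contra h'
        exact hn (Finset.mem_Icc.2 (abs_le.1 (not_lt.1 h')))
      exact_mod_cast this
    linarith [hout n h1]
  have hTo : (T : Set ℤ).OrdConnected := by
    constructor
    intro x hx y hy z hz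
    rw [Finset.mem_coe, hT] at *
    have h1 : (x : ℝ) ≤ z := by exact_mod_cast hz.1
    have h2 : (z : ℝ) ≤ y := by exact_mod_cast hz.2
    have := (hwc.convex_ge 0).ordConnected.out (x := x) ⟨trivial, hx⟩ (y := y) ⟨trivial, hy⟩
      ⟨h1, h2⟩
    exact this.2
  have hTcard : T.card ≤ Q := by
    refine (Finset.card_filter_le _ _).trans ?_
    rw [Int.card_Icc]; omega
  obtain ⟨hfin, hcount⟩ := ncard_envRegion T hT
  refine ⟨hfin, ?_⟩
  have e1 := sum_saw_envelope hA hj hU hs T hTo hTcard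
  have e2 := sum_saw_envelope hA hj hV ht T hTo hTcard
  have hu : w (-((H : ℝ) + 1)) ≤ 0 := (hout _ (by
    rw [abs_neg, abs_of_nonneg (by positivity)]; linarith)).le
  have huv : -((H : ℝ) + 1) + (2 * H + 2 : ℕ) = H + 1 := by push_cast; ring
  have hv : w (-((H : ℝ) + 1) + (2 * H + 2 : ℕ)) ≤ 0 := by
    rw [huv]
    exact (hout _ (by rw [abs_of_nonneg (by positivity)]; linarith)).le
  have e3 := hwc.sum_sub_integral_pos_part hwL (-((H : ℝ) + 1)) (2 * H + 2) hu hv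
  have hvol : (volume (envRegion U V)).toReal
      = ∫ x in (-((H : ℝ) + 1))..(-((H : ℝ) + 1) + (2 * H + 2 : ℕ)), max (w x) 0 := by
    refine volume_envRegion hUL.continuous hVL.continuous (by push_cast; linarith) ?_
    intro x hx
    rw [huv] at hx
    refine (hout x ?_).le
    by_contra h
    have := abs_le.1 (not_lt.1 h)
    exact hx ⟨by linarith, by linarith⟩
  have hsum : ∑ n ∈ T, (U n + V n)
      = ∑ n ∈ Finset.range (2 * H + 2), max (w (-((H : ℝ) + 1) + n)) 0 := by
    have h1 : ∑ n ∈ T, (U n + V n) = ∑ n ∈ Finset.Ico (-((H : ℤ) + 1)) (H + 1), max (w n) 0 := by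
      have hsub : T ⊆ Finset.Ico (-((H : ℤ) + 1)) (H + 1) := by
        intro n hn
        have := Finset.mem_Icc.1 (Finset.mem_filter.1 hn).1
        rw [Finset.mem_Ico]; omega
      rw [← Finset.sum_subset hsub]
      · refine Finset.sum_congr rfl fun n hn => ?_
        rw [max_eq_left]
        · rfl
        · exact (hT n).1 hn
      · intro n _ hn
        rw [hT, not_le] at hn
        exact max_eq_right hn.le
    rw [h1]
    have h2 : Finset.Ico (-((H : ℤ) + 1)) (H + 1)
        = (Finset.range (2 * H + 2)).image (fun n : ℕ => -((H : ℤ) + 1) + (n : ℤ)) := by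
      ext x
      simp only [Finset.mem_Ico, Finset.mem_image, Finset.mem_range]
      constructor
      · rintro ⟨h3, h4⟩
        exact ⟨(x + (H + 1)).toNat, by omega, by omega⟩
      · rintro ⟨n, hn, rfl⟩
        omega
    rw [h2, Finset.sum_image (by intro a _ b _ h; simpa using h)]
    push_cast
    rfl
  rw [hcount, hvol, hsum]
  push_cast at e3 ⊢
  rw [abs_le] at *
  constructor <;> linarith [e1.1, e1.2, e2.1, e2.2, e3.1, e3.2]

theorem one_le_sin_add_cos {θ : ℝ} (hθ : θ ∈ Set.Icc 0 (Real.pi / 2)) :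
    1 ≤ Real.sin θ + Real.cos θ := by
  have hs : 0 ≤ Real.sin θ := Real.sin_nonneg_of_nonneg_of_le_pi hθ.1 (by linarith [hθ.2, Real.pi_pos])
  have hc : 0 ≤ Real.cos θ := Real.cos_nonneg_of_mem_Icc ⟨by linarith [hθ.1, Real.pi_pos], hθ.2⟩
  nlinarith [Real.sin_sq_add_cos_sq θ, mul_nonneg hs hc]

/-- The slope, in the coordinates `(x - y, x + y)`, of the lines with normal
`(cos θ, sin θ)`. -/
def dirSlope (θ : ℝ) : ℝ := (Real.sin θ - Real.cos θ) / (Real.sin θ + Real.cos θ)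

theorem abs_dirSlope_le {θ : ℝ} (hθ : θ ∈ Set.Icc 0 (Real.pi / 2)) : |dirSlope θ| ≤ 1 := by
  have hs : 0 ≤ Real.sin θ := Real.sin_nonneg_of_nonneg_of_le_pi hθ.1 (by linarith [hθ.2, Real.pi_pos])
  have hc : 0 ≤ Real.cos θ := Real.cos_nonneg_of_mem_Icc ⟨by linarith [hθ.1, Real.pi_pos], hθ.2⟩
  have h1 := one_le_sin_add_cos hθ
  rw [dirSlope, abs_div, abs_of_pos (show 0 < Real.sin θ + Real.cos θ by linarith),
    div_le_one (by linarith), abs_le]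
  constructor <;> linarith

theorem abs_dirSlope_sub_le {θ φ : ℝ} (hθ : θ ∈ Set.Icc 0 (Real.pi / 2))
    (hφ : φ ∈ Set.Icc 0 (Real.pi / 2)) : |dirSlope θ - dirSlope φ| ≤ 2 * |θ - φ| := by
  have h1 := one_le_sin_add_cos hθ
  have h2 := one_le_sin_add_cos hφ
  have h3 : 1 ≤ (Real.sin θ + Real.cos θ) * (Real.sin φ + Real.cos φ) := by nlinarith
  have e : dirSlope θ - dirSlope φ
      = 2 * Real.sin (θ - φ) / ((Real.sin θ + Real.cos θ) * (Real.sin φ + Real.cos φ)) := by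
    have h1' : Real.sin θ + Real.cos θ ≠ 0 := by linarith
    have h2' : Real.sin φ + Real.cos φ ≠ 0 := by linarith
    rw [dirSlope, dirSlope, Real.sin_sub, div_sub_div _ _ h1' h2']
    congr 1; ring
  rw [e, abs_div, abs_of_pos (lt_of_lt_of_le one_pos h3), abs_mul, abs_two]
  calc 2 * |Real.sin (θ - φ)| / _ ≤ 2 * |Real.sin (θ - φ)| := div_le_self (by positivity) h3
    _ ≤ 2 * |θ - φ| := by exact mul_le_mul_of_nonneg_left Real.abs_sin_le_abs zero_le_two

theorem LacunaryCovering.exists_slopes {Ω : Set ℝ} {M : ℕ} (hcov : LacunaryCovering Ω M)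
    (hΩ : Ω ⊆ Set.Icc 0 (Real.pi / 2)) :
    ∃ K : ℝ, 0 ≤ K ∧ ∀ δ : ℝ, 0 < δ → δ < 1 / 2 →
      ∃ s : Finset ℝ, (s.card : ℝ) ≤ K * (Real.logb 2 (1 / δ)) ^ M ∧
        ∀ θ ∈ Ω ∪ {0, Real.pi / 2}, ∃ t ∈ s, |dirSlope θ - t| ≤ 2 * δ := by
  classical
  obtain ⟨K, hK⟩ := hcov
  refine ⟨|K| + 2, by positivity, fun δ h0 h1 => ?_⟩
  obtain ⟨s, hs, hsub⟩ := hK δ h0 h1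
  have hlog : 1 ≤ Real.logb 2 (1 / δ) := by
    rw [Real.le_logb_iff_rpow_le (by norm_num) (by positivity), Real.rpow_one, le_div_iff₀ h0]
    linarith
  have hpow : 1 ≤ Real.logb 2 (1 / δ) ^ M := one_le_pow₀ hlog
  have hrep : ∀ x : ℝ, ∃ t : ℝ, ∀ θ ∈ Ω, θ ∈ Set.Icc x (x + δ) → |dirSlope θ - t| ≤ 2 * δ := by
    intro x
    by_cases hx : ∃ φ ∈ Ω, φ ∈ Set.Icc x (x + δ)
    · obtain ⟨φ, hφ, hφx⟩ := hx
      refine ⟨dirSlope φ, fun θ hθ hθx => (abs_dirSlope_sub_le (hΩ hθ) (hΩ hφ)).trans ?_⟩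
      gcongr
      rw [abs_le]
      constructor <;> linarith [hθx.1, hθx.2, hφx.1, hφx.2]
    · exact ⟨0, fun θ hθ hθx => absurd ⟨θ, hθ, hθx⟩ hx⟩
  choose rep hrep using hrep
  refine ⟨s.image rep ∪ {dirSlope 0, dirSlope (Real.pi / 2)}, ?_, ?_⟩
  · have h2 : (s.image rep ∪ {dirSlope 0, dirSlope (Real.pi / 2)}).card ≤ s.card + 2 :=
      (Finset.card_union_le _ _).trans (add_le_add Finset.card_image_le Finset.card_le_two)
    have h3 : ((s.image rep ∪ {dirSlope 0, dirSlope (Real.pi / 2)}).card : ℝ) ≤ s.card + 2 := by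
      exact_mod_cast h2
    nlinarith [le_abs_self K]
  · rintro θ (hθ | hθ)
    · obtain ⟨x, hx, hθx⟩ := Set.mem_iUnion₂.1 (hsub hθ)
      exact ⟨rep x, by simp only [Finset.mem_union, Finset.mem_image]; exact Or.inl ⟨x, hx, rfl⟩,
        hrep x θ hθ hθx⟩
    · refine ⟨dirSlope θ, ?_, by simpa using h0.le⟩
      rcases hθ with rfl | rfl <;> simp

/-- A translate of a finite set avoiding neighbourhoods of the rationals of small height. -/
theorem exists_shift (s : Finset ℝ) (Q : ℕ) {η : ℝ} (hη : 0 < η)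
    (h : 42 * s.card * η * (1 + Real.log Q) < 1) :
    ∃ β ∈ Set.Icc (0 : ℝ) 1, ∀ t ∈ s, ∀ q : ℕ, 1 ≤ q → q ≤ Q → ∀ p : ℤ, |p| ≤ 3 * q →
      3 * η / (q : ℝ) ^ 2 < |β + t - p / q| := by
  classical
  by_contra hcon
  push Not at hcon
  let I : Finset (ℝ × (Σ _ : ℕ, ℤ)) :=
    s ×ˢ (Finset.Icc 1 Q).sigma fun q => Finset.Icc (-(3 * q : ℤ)) (3 * q)
  have hcover : Set.Icc (0 : ℝ) 1 ⊆
      ⋃ i ∈ I, Metric.closedBall ((i.2.2 : ℝ) / i.2.1 - i.1) (3 * η / (i.2.1 : ℝ) ^ 2) := by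
    intro β hβ
    obtain ⟨t, ht, q, hq1, hqQ, p, hp, hle⟩ := hcon β hβ
    refine Set.mem_iUnion₂.2 ⟨(t, ⟨q, p⟩), ?_, ?_⟩
    · simp only [I, Finset.mem_product, Finset.mem_sigma, Finset.mem_Icc]
      exact ⟨ht, ⟨hq1, hqQ⟩, abs_le.1 hp⟩
    · rw [Metric.mem_closedBall, Real.dist_eq]
      have e : β - ((p : ℝ) / q - t) = β + t - p / q := by ring
      rw [e]
      exact hle
  have hvol : ENNReal.ofReal 1 ≤ ENNReal.ofReal (∑ i ∈ I, 2 * (3 * η / (i.2.1 : ℝ) ^ 2)) := by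
    calc ENNReal.ofReal 1 = volume (Set.Icc (0 : ℝ) 1) := by simp
      _ ≤ _ := measure_mono hcover
      _ ≤ _ := measure_biUnion_finset_le _ _
      _ = ∑ i ∈ I, ENNReal.ofReal (2 * (3 * η / (i.2.1 : ℝ) ^ 2)) := by
          simp_rw [Real.volume_closedBall]
      _ = _ := by
          rw [ENNReal.ofReal_sum_of_nonneg]
          intro i _; positivity
  rw [ENNReal.ofReal_le_ofReal_iff (Finset.sum_nonneg fun i _ => by positivity)] at hvol
  have hsum : ∑ i ∈ I, 2 * (3 * η / (i.2.1 : ℝ) ^ 2)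
      ≤ s.card * (42 * η * (1 + Real.log Q)) := by
    simp only [I]
    rw [Finset.sum_product, ← nsmul_eq_mul]
    refine Finset.sum_le_card_nsmul _ _ _ fun t _ => ?_
    rw [Finset.sum_sigma]
    simp only [Finset.sum_const, nsmul_eq_mul]
    calc _ ≤ ∑ q ∈ Finset.Icc 1 Q, 42 * η * (q : ℝ)⁻¹ := by
          refine Finset.sum_le_sum fun q hq => ?_
          have hq1 : 1 ≤ q := (Finset.mem_Icc.1 hq).1
          have hq1' : (1 : ℝ) ≤ q := by exact_mod_cast hq1
          have hc : ((Finset.Icc (-(3 * q : ℤ)) (3 * q)).card : ℝ) ≤ 7 * q := by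
            rw [Int.card_Icc]
            have : (3 * (q : ℤ) + 1 - -(3 * q)).toNat ≤ 7 * q := by omega
            exact_mod_cast this
          calc _ ≤ 7 * (q : ℝ) * (2 * (3 * η / (q : ℝ) ^ 2)) := by gcongr
            _ = 42 * η * (q : ℝ)⁻¹ := by field_simp; ring
      _ = 42 * η * ((harmonic Q : ℚ) : ℝ) := by
          rw [← Finset.mul_sum, harmonic_eq_sum_Icc]; push_cast; rfl
      _ ≤ _ := by gcongr; exact harmonic_le_one_add_log Q
  nlinarith

theorem exists_mul_logb_pow_le (D : ℝ) (hD : 0 < D) (n : ℕ) :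
    ∃ Q₀ : ℕ, 3 ≤ Q₀ ∧ ∀ Q : ℕ, Q₀ ≤ Q → D * Real.logb 2 Q ^ n ≤ (Q : ℝ) ^ 2 := by
  have hl : 0 < Real.log 2 := Real.log_pos (by norm_num)
  have h := (Real.isLittleO_pow_log_id_atTop (n := n)).bound (show 0 < Real.log 2 ^ n / D by positivity)
  obtain ⟨Q₀, hQ₀⟩ := Filter.eventually_atTop.1 (tendsto_natCast_atTop_atTop.eventually h)
  refine ⟨max Q₀ 3, le_max_right _ _, fun Q hQ => ?_⟩
  have h1 := hQ₀ Q (le_trans (le_max_left _ _) hQ)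
  have hQ3 : (3 : ℝ) ≤ Q := by exact_mod_cast (le_trans (le_max_right _ _) hQ)
  simp only [id, Real.norm_eq_abs] at h1
  rw [abs_of_nonneg (show (0 : ℝ) ≤ Q by positivity)] at h1
  have h2 := (le_abs_self _).trans h1
  have h3 : D * Real.logb 2 Q ^ n ≤ Q := by
    rw [Real.logb, div_pow, mul_div_assoc', div_le_iff₀ (by positivity)]
    calc D * Real.log Q ^ n ≤ D * (Real.log 2 ^ n / D * Q) := by gcongr
      _ = Q * Real.log 2 ^ n := by field_simp
  nlinarith

theorem one_le_logb_two {Q : ℕ} (hQ : 2 ≤ Q) : 1 ≤ Real.logb 2 Q := by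
  rw [Real.le_logb_iff_rpow_le (by norm_num) (by exact_mod_cast (by omega : 0 < Q)), Real.rpow_one]
  exact_mod_cast hQ

theorem LacunaryCovering.exists_badlyApprox {Ω : Set ℝ} {M : ℕ} (hcov : LacunaryCovering Ω M)
    (hΩ : Ω ⊆ Set.Icc 0 (Real.pi / 2)) :
    ∃ (D : ℝ) (Q₀ : ℕ), 0 < D ∧ 3 ≤ Q₀ ∧ ∀ Q : ℕ, Q₀ ≤ Q →
      ∃ β ∈ Set.Icc (0 : ℝ) 1, ∀ θ ∈ Ω ∪ {0, Real.pi / 2},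
        BadlyApprox (D * Real.logb 2 Q ^ (M + 1)) Q (β + dirSlope θ) := by
  obtain ⟨K, hK0, hK⟩ := hcov.exists_slopes hΩ
  set D : ℝ := 84 * K * 4 ^ M + 1 with hDdef
  have hD1 : 1 ≤ D := by rw [hDdef]; linarith [show 0 ≤ 84 * K * 4 ^ M by positivity]
  obtain ⟨Q₀, hQ₀3, hQ₀⟩ := exists_mul_logb_pow_le D (by linarith) (M + 1)
  refine ⟨D, Q₀, by linarith, hQ₀3, fun Q hQ => ?_⟩
  have hQ3 : 3 ≤ Q := hQ₀3.trans hQ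
  have hQ3' : (3 : ℝ) ≤ Q := by exact_mod_cast hQ3
  set L := Real.logb 2 Q with hL
  have hL1 : 1 ≤ L := one_le_logb_two (by omega)
  have hLp : 1 ≤ L ^ (M + 1) := one_le_pow₀ hL1
  have hDL : 0 < D * L ^ (M + 1) := by positivity
  set η := 1 / (D * L ^ (M + 1)) with hη
  have hη0 : 0 < η := by positivity
  have hη1 : η ≤ 1 := by
    rw [hη, div_le_one hDL]; nlinarith
  have hδ : 1 / (Q : ℝ) ^ 4 < 1 / 2 := by
    apply one_div_lt_one_div_of_lt (by norm_num)
    calc (2 : ℝ) < 3 ^ 4 := by norm_num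
      _ ≤ (Q : ℝ) ^ 4 := by gcongr
  obtain ⟨s, hcard, hs⟩ := hK (1 / (Q : ℝ) ^ 4) (by positivity) hδ
  have hlog4 : Real.logb 2 (1 / (1 / (Q : ℝ) ^ 4)) = 4 * L := by
    rw [one_div_one_div, Real.logb_pow]; norm_num [hL]
  rw [hlog4, mul_pow] at hcard
  have hlogQ : Real.log Q ≤ L := by
    have h2 : Real.log 2 ≤ 1 := by linarith [Real.log_two_lt_d9]
    have h3 : 0 < Real.log 2 := Real.log_pos (by norm_num)
    have h4 : Real.log Q = L * Real.log 2 := by rw [hL, Real.logb]; field_simp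
    rw [h4]; nlinarith
  have hsmall : 42 * s.card * η * (1 + Real.log Q) < 1 := by
    calc 42 * s.card * η * (1 + Real.log Q)
        ≤ 42 * (K * (4 ^ M * L ^ M)) * η * (2 * L) := by
          have : 0 ≤ Real.log Q := Real.log_nonneg (by linarith)
          gcongr; linarith
      _ = (84 * K * 4 ^ M) / D := by rw [hη]; field_simp; ring
      _ < 1 := by rw [div_lt_one (by linarith)]; linarith
  obtain ⟨β, hβ, hbad⟩ := exists_shift s Q hη0 hsmall
  refine ⟨β, hβ, fun θ hθ q hq1 hqQ p => ?_⟩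
  have hθI : θ ∈ Set.Icc 0 (Real.pi / 2) := by
    rcases hθ with h | rfl | rfl
    · exact hΩ h
    · exact ⟨le_rfl, by positivity⟩
    · exact ⟨by positivity, le_rfl⟩
  have hq1' : (1 : ℝ) ≤ q := by exact_mod_cast hq1
  have hqQ' : (q : ℝ) ≤ Q := by exact_mod_cast hqQ
  have hηq : 1 / (D * L ^ (M + 1) * (q : ℝ) ^ 2) = η / (q : ℝ) ^ 2 := by
    rw [hη]; field_simp
  rw [hηq]
  by_cases hp : |p| ≤ 3 * q
  · obtain ⟨t, ht, htθ⟩ := hs θ hθ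
    have h1 := hbad t ht q hq1 hqQ p hp
    have h2 : 1 / (Q : ℝ) ^ 4 ≤ η / (q : ℝ) ^ 2 := by
      have h3 := hQ₀ Q hQ
      rw [hη, div_div]
      apply one_div_le_one_div_of_le (by positivity)
      calc D * L ^ (M + 1) * (q : ℝ) ^ 2 ≤ (Q : ℝ) ^ 2 * (Q : ℝ) ^ 2 := by gcongr
        _ = (Q : ℝ) ^ 4 := by ring
    have h4 : |β + t - p / q| ≤ |β + dirSlope θ - p / q| + |dirSlope θ - t| := by
      rw [abs_sub_comm (dirSlope θ) t]
      refine le_trans (le_of_eq ?_) (abs_add_le _ _)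
      congr 1; ring
    have h5 : 3 * η / (q : ℝ) ^ 2 = 3 * (η / (q : ℝ) ^ 2) := by ring
    linarith
  · have h1 : (3 : ℝ) * q ≤ |(p : ℝ)| := by
      have : 3 * (q : ℤ) ≤ |p| := (not_le.1 hp).le
      exact_mod_cast this
    have h2 : 3 ≤ |(p : ℝ) / q| := by
      rw [abs_div, Nat.abs_cast, le_div_iff₀ (by linarith)]; exact h1
    have h3 := abs_dirSlope_le hθI
    have h4 : |β + dirSlope θ| ≤ 2 := by
      rw [abs_le] at *
      constructor <;> linarith [hβ.1, hβ.2, h3.1, h3.2]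
    have h5 := abs_sub_abs_le_abs_sub ((p : ℝ) / q) (β + dirSlope θ)
    rw [abs_sub_comm] at h5
    have h6 : η / (q : ℝ) ^ 2 ≤ 1 := by
      rw [div_le_one (by positivity)]; nlinarith
    linarith

theorem IsEnvelope.le_iff {ι : Type*} {F : ℝ → ℝ} {s a : ι → ℝ} (hF : IsEnvelope F s a)
    (x y : ℝ) : y ≤ F x ↔ ∀ i, y ≤ s i * x + a i := by
  refine ⟨fun h i => h.trans (hF.le x i), fun h => ?_⟩
  obtain ⟨i, hi⟩ := hF.eq x
  rw [hi]
  exact h i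

/-- The linear map `(x, y) ↦ (r (x - y), r (x + y) + β r (x - y))`. -/
def latticeMap (r β : ℝ) : ℝ × ℝ →ₗ[ℝ] ℝ × ℝ :=
  Matrix.toLin (Module.Basis.finTwoProd ℝ) (Module.Basis.finTwoProd ℝ)
    !![r, -r; r + β * r, r - β * r]

theorem latticeMap_apply (r β : ℝ) (p : ℝ × ℝ) :
    latticeMap r β p = (r * (p.1 - p.2), r * (p.1 + p.2) + β * (r * (p.1 - p.2))) := by
  rw [latticeMap, Matrix.toLin_finTwoProd_apply]
  ext <;> simp <;> ring

theorem volume_latticeMap_image {r : ℝ} (β : ℝ) (B : Set (ℝ × ℝ)) :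
    (volume (latticeMap r β '' B)).toReal = 2 * r ^ 2 * (volume B).toReal := by
  have hdet : LinearMap.det (latticeMap r β) = 2 * r ^ 2 := by
    rw [latticeMap, LinearMap.det_toLin, Matrix.det_fin_two_of]; ring
  rw [Measure.addHaar_image_linearMap, hdet, ENNReal.toReal_mul,
    ENNReal.toReal_ofReal (abs_nonneg _), abs_of_nonneg (by positivity)]

theorem latticeMap_bijective {r : ℝ} (hr : 0 < r) (β : ℝ) :
    Function.Bijective (latticeMap r β) := by
  constructor
  · intro p p' h
    rw [latticeMap_apply, latticeMap_apply, Prod.mk.injEq] at h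
    obtain ⟨h1, h2⟩ := h
    rw [h1, add_left_inj] at h2
    have h3 := mul_left_cancel₀ hr.ne' h1
    have h4 := mul_left_cancel₀ hr.ne' h2
    ext <;> linarith
  · intro z
    refine ⟨(((1 - β) * z.1 + z.2) / (2 * r), (z.2 - (1 + β) * z.1) / (2 * r)), ?_⟩
    rw [latticeMap_apply]
    ext <;> · field_simp; ring

theorem halfplane_iff {r : ℝ} (hr : 0 < r) (β : ℝ) {θ : ℝ} (hθ : θ ∈ Set.Icc 0 (Real.pi / 2))
    (c : ℝ) (p : ℝ × ℝ) :
    (p.1 * Real.cos θ + p.2 * Real.sin θ ≤ c ↔ (latticeMap r β p).2 ≤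
      (β + dirSlope θ) * (latticeMap r β p).1 + 2 * r * c / (Real.sin θ + Real.cos θ)) ∧
    (-(p.1 * Real.cos θ + p.2 * Real.sin θ) ≤ c ↔ -(latticeMap r β p).2 ≤
      -(β + dirSlope θ) * (latticeMap r β p).1 + 2 * r * c / (Real.sin θ + Real.cos θ)) := by
  have hd : 0 < Real.sin θ + Real.cos θ := lt_of_lt_of_le one_pos (one_le_sin_add_cos hθ)
  have hk : 0 < 2 * r / (Real.sin θ + Real.cos θ) := by positivity
  have key : (latticeMap r β p).2 - (β + dirSlope θ) * (latticeMap r β p).1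
      = 2 * r / (Real.sin θ + Real.cos θ) * (p.1 * Real.cos θ + p.2 * Real.sin θ) := by
    rw [latticeMap_apply, dirSlope]
    field_simp
    ring
  have hc : 2 * r * c / (Real.sin θ + Real.cos θ) = 2 * r / (Real.sin θ + Real.cos θ) * c := by
    ring
  constructor
  · rw [← mul_le_mul_iff_right₀ hk, ← key, hc]
    constructor <;> intro h <;> linarith
  · rw [← mul_le_mul_iff_right₀ hk, mul_neg, ← key, hc]
    constructor <;> intro h <;> linarith

theorem mem_unitSq_iff (p : ℝ × ℝ) :
    p ∈ unitSq ↔ (p.1 ≤ 1 ∧ p.2 ≤ 1) ∧ (-p.1 ≤ 0 ∧ -p.2 ≤ 0) := by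
  simp only [unitSq, Set.mem_prod, Set.mem_Icc, neg_nonpos]
  tauto

/-- The discrepancy of the preimage of `ℤ²` under `latticeMap r β` for a polygon in the unit square. -/
theorem lattice_discrepancy {A : ℝ} (hA : 0 < A) {Q j N : ℕ} (hj : Q < 2 ^ j)
    (hNQ : 2 * N + 1 ≤ Q) {r β : ℝ} (hr : 0 < r) (hrN : r ≤ N) (hβ : β ∈ Set.Icc (0 : ℝ) 1)
    {Ω : Set ℝ} (hΩ : Ω ⊆ Set.Icc 0 (Real.pi / 2))
    (hbad : ∀ θ ∈ Ω ∪ {0, Real.pi / 2}, BadlyApprox A Q (β + dirSlope θ))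
    {m : ℕ} {θ ε c : Fin m → ℝ} (hθ : ∀ i, θ i ∈ Ω) (hε : ∀ i, ε i = 1 ∨ ε i = -1)
    {B : Set (ℝ × ℝ)} (hB : B = unitSq ∩ ⋂ i, {x : ℝ × ℝ |
      x.1 * (ε i * Real.cos (θ i)) + x.2 * (ε i * Real.sin (θ i)) ≤ c i}) :
    {z : ℤ × ℤ | ((z.1 : ℝ), (z.2 : ℝ)) ∈ latticeMap r β '' B}.Finite ∧
    |({z : ℤ × ℤ | ((z.1 : ℝ), (z.2 : ℝ)) ∈ latticeMap r β '' B}.ncard : ℝ)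
      - 2 * r ^ 2 * (volume B).toReal| ≤ (2 * m + 4) * (5 / 2 * A * j) + 8 := by
  classical
  let θu : Fin 2 ⊕ {i // ε i = 1} → ℝ := Sum.elim ![0, Real.pi / 2] fun i => θ i
  let cu : Fin 2 ⊕ {i // ε i = 1} → ℝ := Sum.elim ![1, 1] fun i => c i
  let θl : Fin 2 ⊕ {i // ε i = -1} → ℝ := Sum.elim ![0, Real.pi / 2] fun i => θ i
  let cl : Fin 2 ⊕ {i // ε i = -1} → ℝ := Sum.elim ![0, 0] fun i => c i
  have hΩ' : Ω ∪ {0, Real.pi / 2} ⊆ Set.Icc 0 (Real.pi / 2) := by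
    rintro x (h | rfl | rfl)
    · exact hΩ h
    · exact ⟨le_rfl, by positivity⟩
    · exact ⟨by positivity, le_rfl⟩
  have hθu : ∀ i, θu i ∈ Ω ∪ {0, Real.pi / 2} := by
    rintro (i | i)
    · fin_cases i <;> simp [θu]
    · exact Or.inl (hθ i)
  have hθl : ∀ i, θl i ∈ Ω ∪ {0, Real.pi / 2} := by
    rintro (i | i)
    · fin_cases i <;> simp [θl]
    · exact Or.inl (hθ i)
  have hslope : ∀ φ ∈ Ω ∪ {0, Real.pi / 2}, |β + dirSlope φ| ≤ 2 := by
    intro φ hφ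
    have := abs_dirSlope_le (hΩ' hφ)
    rw [abs_le] at *
    constructor <;> linarith [hβ.1, hβ.2, this.1, this.2]
  obtain ⟨U, hU⟩ := exists_isEnvelope (fun i => β + dirSlope (θu i))
    (fun i => 2 * r * cu i / (Real.sin (θu i) + Real.cos (θu i)))
  obtain ⟨V, hV⟩ := exists_isEnvelope (fun i => -(β + dirSlope (θl i)))
    (fun i => 2 * r * cl i / (Real.sin (θl i) + Real.cos (θl i)))
  have hmem : ∀ p, p ∈ B ↔ latticeMap r β p ∈ envRegion U V := by
    intro p
    have hu : (latticeMap r β p).2 ≤ U (latticeMap r β p).1 ↔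
        ∀ i, p.1 * Real.cos (θu i) + p.2 * Real.sin (θu i) ≤ cu i := by
      rw [hU.le_iff]
      exact forall_congr' fun i => ((halfplane_iff hr β (hΩ' (hθu i)) (cu i) p).1).symm
    have hl : -V (latticeMap r β p).1 ≤ (latticeMap r β p).2 ↔
        ∀ i, -(p.1 * Real.cos (θl i) + p.2 * Real.sin (θl i)) ≤ cl i := by
      rw [neg_le, hV.le_iff]
      exact forall_congr' fun i => ((halfplane_iff hr β (hΩ' (hθl i)) (cl i) p).2).symm
    have henv : latticeMap r β p ∈ envRegion U V ↔
        -V (latticeMap r β p).1 ≤ (latticeMap r β p).2 ∧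
        (latticeMap r β p).2 ≤ U (latticeMap r β p).1 := Iff.rfl
    have hinter : p ∈ (⋂ i, {x : ℝ × ℝ |
        x.1 * (ε i * Real.cos (θ i)) + x.2 * (ε i * Real.sin (θ i)) ≤ c i}) ↔
        ∀ i, p.1 * (ε i * Real.cos (θ i)) + p.2 * (ε i * Real.sin (θ i)) ≤ c i := by
      rw [Set.mem_iInter]; rfl
    rw [henv, hu, hl, hB, Set.mem_inter_iff, mem_unitSq_iff, hinter, Sum.forall, Sum.forall,
      Fin.forall_fin_two, Fin.forall_fin_two]
    simp only [θu, cu, θl, cl, Sum.elim_inl, Sum.elim_inr, Matrix.cons_val_zero,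
      Matrix.cons_val_one, Real.cos_zero, Real.sin_zero, Real.cos_pi_div_two,
      Real.sin_pi_div_two, mul_one, mul_zero, add_zero, zero_add]
    constructor
    · rintro ⟨⟨h1, h2⟩, h3⟩
      refine ⟨⟨h2, fun i => ?_⟩, h1, fun i => ?_⟩
      · have := h3 i; rw [i.2] at this; linarith
      · have := h3 i; rw [i.2] at this; linarith
    · rintro ⟨⟨h2, h4⟩, h1, h3⟩
      refine ⟨⟨h1, h2⟩, fun i => ?_⟩
      rcases hε i with h | h
      · have := h3 ⟨i, h⟩; rw [h]; linarith
      · have := h4 ⟨i, h⟩; rw [h]; linarith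
  have himg : latticeMap r β '' B = envRegion U V := by
    ext z
    constructor
    · rintro ⟨p, hp, rfl⟩
      exact (hmem p).1 hp
    · intro hz
      obtain ⟨p, rfl⟩ := (latticeMap_bijective hr β).2 z
      exact ⟨p, (hmem p).2 hz, rfl⟩
  have hout : ∀ x : ℝ, N < |x| → U x + V x < 0 := by
    intro x hx
    by_contra h
    have hz : (x, U x) ∈ envRegion U V := ⟨by simp only; linarith, le_rfl⟩
    rw [← himg] at hz
    obtain ⟨p, hp, hpx⟩ := hz
    rw [hB] at hp
    have hsq := (mem_unitSq_iff p).1 hp.1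
    rw [latticeMap_apply, Prod.mk.injEq] at hpx
    have h1 : |p.1 - p.2| ≤ 1 := by
      rw [abs_le]; constructor <;> linarith [hsq.1.1, hsq.1.2, hsq.2.1, hsq.2.2]
    rw [← hpx.1, abs_mul, abs_of_pos hr] at hx
    nlinarith
  have hmain := envRegion_discrepancy hA hj hU hV (fun i => hbad _ (hθu i))
    (fun i => (hbad _ (hθl i)).neg) (fun i => hslope _ (hθu i))
    (fun i => by rw [abs_neg]; exact hslope _ (hθl i)) hNQ hout
  rw [← himg, volume_latticeMap_image] at hmain
  refine ⟨hmain.1, hmain.2.trans ?_⟩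
  have hcard : ∀ p : Fin m → Prop, ∀ [Fintype {i // p i}],
      (Fintype.card (Fin 2 ⊕ {i // p i}) : ℝ) ≤ m + 2 := by
    intro p _
    have h := Fintype.card_subtype_le p
    rw [Fintype.card_fin] at h
    rw [Fintype.card_sum, Fintype.card_fin, Nat.cast_add, Nat.cast_ofNat, add_comm]
    exact add_le_add_left (Nat.cast_le.2 h) _
  have c1 := hcard (fun i => ε i = 1)
  have c2 := hcard (fun i => ε i = -1)
  have hX : 0 ≤ 5 / 2 * A * j := by positivity
  nlinarith [mul_le_mul_of_nonneg_right (add_le_add c1 c2) hX]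

theorem unitSq_infinite : unitSq.Infinite := by
  have h : (Set.Icc (0 : ℝ) 1).Infinite := Set.Icc_infinite one_pos
  exact h.prod_left ⟨0, by simp⟩

/-- Changing the cardinality of a point set in the unit square to a prescribed value. -/
theorem exists_finset_card_eq (P₀ : Finset (ℝ × ℝ)) (hP₀ : (P₀ : Set (ℝ × ℝ)) ⊆ unitSq) (N : ℕ) :
    ∃ P : Finset (ℝ × ℝ), P.card = N ∧ (P : Set (ℝ × ℝ)) ⊆ unitSq ∧
      ∀ B : Set (ℝ × ℝ), |(((P : Set (ℝ × ℝ)) ∩ B).ncard : ℝ) - ((P₀ : Set (ℝ × ℝ)) ∩ B).ncard|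
        ≤ |(P₀.card : ℝ) - N| := by
  classical
  have hsub : ∀ P P' : Finset (ℝ × ℝ), P ⊆ P' → ∀ B : Set (ℝ × ℝ),
      (((P : Set (ℝ × ℝ)) ∩ B).ncard : ℝ) ≤ ((P' : Set (ℝ × ℝ)) ∩ B).ncard ∧
      (((P' : Set (ℝ × ℝ)) ∩ B).ncard : ℝ) ≤ ((P : Set (ℝ × ℝ)) ∩ B).ncard + (P'.card - P.card) := by
    intro P P' h B
    have h1 : ∀ R : Finset (ℝ × ℝ), ((R : Set (ℝ × ℝ)) ∩ B) = (R.filter (· ∈ B) : Finset _) := by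
      intro R; ext; simp
    simp only [h1, Set.ncard_coe_finset]
    have h2 : P.filter (· ∈ B) ⊆ P'.filter (· ∈ B) := Finset.filter_subset_filter _ h
    refine ⟨by exact_mod_cast Finset.card_le_card h2, ?_⟩
    have h3 : P'.filter (· ∈ B) ⊆ P.filter (· ∈ B) ∪ (P' \ P) := by
      intro x hx
      simp only [Finset.mem_filter, Finset.mem_union, Finset.mem_sdiff] at hx ⊢
      tauto
    have h4 := (Finset.card_le_card h3).trans (Finset.card_union_le _ _)
    have h5 : ((P' \ P).card : ℝ) = P'.card - P.card := by
      rw [Finset.cast_card_sdiff h]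
    rw [← h5]
    exact_mod_cast h4
  rcases le_total N P₀.card with h | h
  · obtain ⟨P, hP, hcard⟩ := Finset.exists_subset_card_eq h
    refine ⟨P, hcard, (Finset.coe_subset.2 hP).trans hP₀, fun B => ?_⟩
    obtain ⟨h1, h2⟩ := hsub P P₀ hP B
    rw [hcard] at h2
    have h3 := le_abs_self ((P₀.card : ℝ) - N)
    rw [abs_le]
    constructor <;> linarith
  · obtain ⟨t, ht, htcard⟩ :=
      (unitSq_infinite.sdiff P₀.finite_toSet).exists_subset_card_eq (N - P₀.card)
    have hdisj : Disjoint P₀ t := Finset.disjoint_left.2 fun x hx hxt => (ht hxt).2 hx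
    have hcard : (P₀ ∪ t).card = N := by
      rw [Finset.card_union_of_disjoint hdisj, htcard]; omega
    refine ⟨P₀ ∪ t, hcard, ?_, fun B => ?_⟩
    · rw [Finset.coe_union]
      exact Set.union_subset hP₀ (ht.trans Set.sdiff_subset)
    obtain ⟨h1, h2⟩ := hsub P₀ (P₀ ∪ t) Finset.subset_union_left B
    rw [hcard] at h2
    have h3 := neg_abs_le ((P₀.card : ℝ) - N)
    rw [abs_le]
    constructor <;> linarith

theorem ncard_lattice_inter {r β : ℝ} (hr : 0 < r) {S B : Set (ℝ × ℝ)} (hBS : B ⊆ S) :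
    ({p ∈ S | ∃ z : ℤ × ℤ, latticeMap r β p = ((z.1 : ℝ), (z.2 : ℝ))} ∩ B).ncard
      = {z : ℤ × ℤ | ((z.1 : ℝ), (z.2 : ℝ)) ∈ latticeMap r β '' B}.ncard := by
  have hinj : Function.Injective fun z : ℤ × ℤ => ((z.1 : ℝ), (z.2 : ℝ)) := by
    intro z z' h
    simpa [Prod.ext_iff] using h
  rw [← Set.ncard_image_of_injective _ (latticeMap_bijective hr β).1,
    ← Set.ncard_image_of_injective _ hinj]
  congr 1
  ext y
  constructor
  · rintro ⟨p, ⟨⟨-, z, hz⟩, hp⟩, rfl⟩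
    exact ⟨z, ⟨p, hp, hz⟩, hz.symm⟩
  · rintro ⟨z, ⟨p, hp, hz⟩, rfl⟩
    exact ⟨p, ⟨⟨hBS hp, z, hz⟩, hp⟩, hz⟩

/-- If `Ω ⊆ [0, π/2]` is lacunary of order `M ≥ 1` and `k ≥ 3`, then for every `N ≥ 2`
there is an `N`-point set `P ⊆ [0,1]²` whose discrepancy with respect to every convex
polygon `B ⊆ [0,1]²` with at most `k` sides and normals in `±Ω` is at most
`C (log N)^{2M+1}`. -/
theorem polygon_discrepancy_lacunary_order_M
    (M : ℕ) (hM : 1 ≤ M) (k : ℕ) (hk : 3 ≤ k)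
    (Ω : Set ℝ) (hΩ : Ω ⊆ Set.Icc 0 (Real.pi / 2))
    (hcov : LacunaryCovering Ω M) :
    ∃ C : ℝ, 0 < C ∧ ∀ N : ℕ, 2 ≤ N →
      ∃ P : Finset (ℝ × ℝ), P.card = N ∧ (P : Set (ℝ × ℝ)) ⊆ unitSq ∧
        ∀ B : Set (ℝ × ℝ), IsDirPolygon Ω k B → B ⊆ unitSq →
          |(((P : Set (ℝ × ℝ)) ∩ B).ncard : ℝ) - (N : ℝ) * (volume B).toReal|
            ≤ C * (plog N) ^ (2 * M + 1) := by
  obtain ⟨D, Q₀, hD, hQ₀, hbad⟩ := hcov.exists_badlyApprox hΩ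
  set G : ℝ := 1 + Real.logb 2 Q₀ with hG
  have hlQ₀ : 1 ≤ Real.logb 2 Q₀ := one_le_logb_two (by omega)
  refine ⟨2 * ((5 * (2 * k + 4) * D + 8) * G ^ (2 * M + 1)), by positivity, fun N hN => ?_⟩
  have hN' : (2 : ℝ) ≤ N := by exact_mod_cast hN
  obtain ⟨β, hβ, hβbad⟩ := hbad (Q₀ * N) (Nat.le_mul_of_pos_right _ (by omega))
  set Q := Q₀ * N with hQ
  set L := Real.logb 2 (Q : ℕ) with hL
  set j := Nat.log 2 Q + 1 with hj
  have hQ2 : 2 * N + 1 ≤ Q := by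
    have : 3 * N ≤ Q₀ * N := Nat.mul_le_mul_right N hQ₀
    omega
  have hL1 : 1 ≤ L := one_le_logb_two (by omega)
  have hplog : 1 ≤ plog N := le_max_left _ _
  have hLG : L ≤ G * plog N := by
    have h1 : Real.logb 2 N ≤ plog N := le_max_right _ _
    have h2 : L = Real.logb 2 Q₀ + Real.logb 2 N := by
      rw [hL, hQ, Nat.cast_mul, Real.logb_mul (by positivity) (by positivity)]
    rw [h2, hG]
    nlinarith
  have hjL : (j : ℝ) ≤ 2 * L := by
    have := Real.natLog_le_logb Q 2
    push_cast at this
    rw [hj]; push_cast; linarith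
  have hA : 0 < D * L ^ (M + 1) := by positivity
  set E : ℝ := (5 * (2 * k + 4) * D + 8) * G ^ (2 * M + 1) * plog N ^ (2 * M + 1) with hE
  have hbound : ∀ m : ℕ, m ≤ k → (2 * m + 4) * (5 / 2 * (D * L ^ (M + 1)) * j) + 8 ≤ E := by
    intro m hm
    have hm' : (m : ℝ) ≤ k := by exact_mod_cast hm
    have hpow : L ^ (M + 2) ≤ G ^ (2 * M + 1) * plog N ^ (2 * M + 1) := by
      calc L ^ (M + 2) ≤ L ^ (2 * M + 1) := pow_le_pow_right₀ hL1 (by omega)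
        _ ≤ (G * plog N) ^ (2 * M + 1) := by gcongr
        _ = _ := mul_pow _ _ _
    have hone : 1 ≤ L ^ (M + 2) := one_le_pow₀ hL1
    calc (2 * m + 4) * (5 / 2 * (D * L ^ (M + 1)) * j) + 8
        ≤ (2 * k + 4) * (5 / 2 * (D * L ^ (M + 1)) * (2 * L)) + 8 * L ^ (M + 2) := by
          gcongr; linarith
      _ = (5 * (2 * k + 4) * D + 8) * L ^ (M + 2) := by ring
      _ ≤ (5 * (2 * k + 4) * D + 8) * (G ^ (2 * M + 1) * plog N ^ (2 * M + 1)) := by gcongr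
      _ = E := by rw [hE]; ring
  set r := Real.sqrt (N / 2) with hrdef
  have hr : 0 < r := Real.sqrt_pos.2 (by positivity)
  have hr2 : 2 * r ^ 2 = N := by rw [hrdef, Real.sq_sqrt (by positivity)]; ring
  have hrN : r ≤ N := by rw [hrdef, Real.sqrt_le_left (by positivity)]; nlinarith
  have hQj : Q < 2 ^ j := Nat.lt_pow_succ_log_self (by norm_num) Q
  have hdisc : ∀ (m : ℕ), m ≤ k → ∀ θ ε c : Fin m → ℝ, (∀ i, θ i ∈ Ω) →
      (∀ i, ε i = 1 ∨ ε i = -1) → ∀ B : Set (ℝ × ℝ), B = unitSq ∩ ⋂ i, {x : ℝ × ℝ |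
        x.1 * (ε i * Real.cos (θ i)) + x.2 * (ε i * Real.sin (θ i)) ≤ c i} →
      {z : ℤ × ℤ | ((z.1 : ℝ), (z.2 : ℝ)) ∈ latticeMap r β '' B}.Finite ∧
      |(({p ∈ unitSq | ∃ z : ℤ × ℤ, latticeMap r β p = ((z.1 : ℝ), (z.2 : ℝ))} ∩ B).ncard : ℝ)
        - N * (volume B).toReal| ≤ E := by
    intro m hm θ ε c hθ hε B hB
    have h := lattice_discrepancy hA hQj hQ2 hr hrN hβ hΩ hβbad hθ hε hB
    rw [ncard_lattice_inter hr (by rw [hB]; exact Set.inter_subset_left), ← hr2]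
    exact ⟨h.1, h.2.trans (hbound m hm)⟩
  have hsq := hdisc 0 (Nat.zero_le k) Fin.elim0 Fin.elim0 Fin.elim0 (fun i => i.elim0)
    (fun i => i.elim0) unitSq (by simp)
  have hfin : {p ∈ unitSq | ∃ z : ℤ × ℤ, latticeMap r β p = ((z.1 : ℝ), (z.2 : ℝ))}.Finite := by
    refine Set.Finite.of_finite_image ((hsq.1.image fun z : ℤ × ℤ => ((z.1 : ℝ), (z.2 : ℝ))).subset
      ?_) (latticeMap_bijective hr β).1.injOn
    rintro y ⟨p, ⟨hp, z, hz⟩, rfl⟩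
    exact ⟨z, ⟨p, hp, hz⟩, hz.symm⟩
  have hvol : (volume unitSq).toReal = 1 := by
    rw [unitSq, Measure.volume_eq_prod, Measure.prod_prod]; simp
  obtain ⟨P, hcard, hPs, hP⟩ := exists_finset_card_eq hfin.toFinset
    (by rw [hfin.coe_toFinset]; exact Set.sep_subset _ _) N
  refine ⟨P, hcard, hPs, ?_⟩
  rintro B ⟨-, m, hm, θ, ε, c, hθ, hε, hB⟩ hBs
  have h1 := (hdisc m hm θ ε c hθ hε B (by rw [← hB, Set.inter_eq_right.2 hBs])).2
  have h2 := hP B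
  have h3 := hsq.2
  rw [hvol, mul_one, Set.inter_eq_left.2 (Set.sep_subset _ _),
    Set.ncard_eq_toFinset_card _ hfin] at h3
  rw [hfin.coe_toFinset] at h2
  have h4 := abs_sub_le (((P : Set (ℝ × ℝ)) ∩ B).ncard : ℝ)
    ({p ∈ unitSq | ∃ z : ℤ × ℤ, latticeMap r β p = ((z.1 : ℝ), (z.2 : ℝ))} ∩ B).ncard
    (N * (volume B).toReal)
  linarith

end
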